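/- arXiv:1401.2350 — 4 statements merged into one kernel-verified Lean document; each statement's English description precedes it below -/
import Mathlib

section
/- There exists an invertible N×N real diagonal matrix D such that D⁻¹ (BᵀB) D = A. In particular, A and BᵀB have the same characteristic polynomial. -/
open Matrix

/-- A sum against column `i` of an upper bidiagonal array with diagonal `a` and superdiagonal `b`. -/
theorem sum_range_bidiagonal_mul {R : Type*} [Semiring R] (a b f : ℕ → R) (hb : b 0 = 0)
    {i N : ℕ} (hi : i < N) :
    ∑ k ∈ Finset.range N,
        (if i = k then a (k + 1) else if i = k + 1 then b (k + 1) else 0) * f k =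
      a (i + 1) * f i + b i * f (i - 1) := by
  rcases i with _ | m
  · rw [Finset.sum_eq_single_of_mem 0 (Finset.mem_range.2 hi) fun k _ hk => by simp [hk.symm]]
    simp [hb]
  · have hm : m < N := by omega
    have hsplit : ∀ k, (if m + 1 = k then a (k + 1) else if m + 1 = k + 1 then b (k + 1) else 0) *
        f k = (if m + 1 = k then a (k + 1) * f k else 0) +
          (if m = k then b (k + 1) * f k else 0) := by
      intro k
      by_cases h₁ : m + 1 = k
      · have h₂ : m ≠ k := by omega
        simp [h₁, h₂]
      · by_cases h₂ : m = k <;> simp [h₁, h₂]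
    rw [Finset.sum_congr rfl fun k _ => hsplit k, Finset.sum_add_distrib]
    simp [hi, hm]

/-- Conjugation by an invertible diagonal matrix, checked entrywise. -/
theorem Matrix.diagonal_inv_mul_mul_diagonal_eq {n K : Type*} [Fintype n] [DecidableEq n] [Field K]
    {M A : Matrix n n K} {d : n → K} (hd : ∀ i, d i ≠ 0)
    (h : ∀ i j, M i j * d j = d i * A i j) :
    IsUnit (diagonal d) ∧ (diagonal d)⁻¹ * M * diagonal d = A := by
  have hu : IsUnit (diagonal d) := by
    rw [isUnit_diagonal, Pi.isUnit_iff]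
    exact fun i => (hd i).isUnit
  have hMA : M * diagonal d = diagonal d * A := by
    ext i j
    rw [mul_diagonal, diagonal_mul, h]
  refine ⟨hu, ?_⟩
  rw [Matrix.mul_assoc, hMA, nonsing_inv_mul_cancel_left _ _ ((isUnit_iff_isUnit_det _).1 hu)]

/-- `BᵀB` is diagonally similar to the tridiagonal matrix `A`;
in particular they have the same characteristic polynomial. -/
theorem stmt_6 (N : ℕ) (hN : 0 < N) (q e : ℕ → ℝ)
    (hq : ∀ i, 1 ≤ i → i ≤ N → 0 < q i)
    (he : ∀ i, 1 ≤ i → i ≤ N - 1 → 0 < e i)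
    (he0 : e 0 = 0)
    (B : Matrix (Fin N) (Fin N) ℝ)
    (hB : ∀ i j : Fin N,
      B i j = if (j : ℕ) = (i : ℕ) then Real.sqrt (q ((i : ℕ) + 1))
              else if (j : ℕ) = (i : ℕ) + 1 then Real.sqrt (e ((i : ℕ) + 1))
              else 0)
    (A : Matrix (Fin N) (Fin N) ℝ)
    (hA : ∀ i j : Fin N,
      A i j = if (j : ℕ) = (i : ℕ) then q ((i : ℕ) + 1) + e (i : ℕ)
              else if (j : ℕ) = (i : ℕ) + 1 then q ((i : ℕ) + 1) * e ((i : ℕ) + 1)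
              else if (i : ℕ) = (j : ℕ) + 1 then 1
              else 0) :
    (∃ D : Matrix (Fin N) (Fin N) ℝ, D.IsDiag ∧ IsUnit D ∧ D⁻¹ * (Bᵀ * B) * D = A) ∧
      A.charpoly = (Bᵀ * B).charpoly := by
  set d : ℕ → ℝ := fun i => ∏ k ∈ Finset.range i, √(q (k + 1)) * √(e (k + 1))
  have hd_succ (i : ℕ) : d (i + 1) = d i * (√(q (i + 1)) * √(e (i + 1))) :=
    Finset.prod_range_succ _ _
  have hd (i : Fin N) : d i ≠ 0 := by
    refine (Finset.prod_pos fun k hk => ?_).ne'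
    have hk' := Finset.mem_range.1 hk
    have h₁ := hq (k + 1) (by omega) (by omega)
    have h₂ := he (k + 1) (by omega) (by omega)
    positivity
  have hM (i j : Fin N) : (Bᵀ * B) i j =
      √(q (i + 1)) * (if (j : ℕ) = i then √(q (i + 1)) else
        if (j : ℕ) = i + 1 then √(e (i + 1)) else 0) +
      √(e i) * (if (j : ℕ) = i - 1 then √(q (i - 1 + 1)) else
        if (j : ℕ) = i - 1 + 1 then √(e (i - 1 + 1)) else 0) := by
    simp only [mul_apply, transpose_apply, hB]
    rw [← sum_range_bidiagonal_mul (fun k => √(q k)) (fun k => √(e k))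
      (fun k => if (j : ℕ) = k then √(q (k + 1)) else if (j : ℕ) = k + 1 then √(e (k + 1)) else 0)
      (by simp [he0]) i.isLt, Finset.sum_range]
  have hentry (i j : Fin N) : (Bᵀ * B) i j * d j = d i * A i j := by
    rw [hM, hA]
    obtain ⟨i, hi⟩ := i
    obtain ⟨j, hj⟩ := j
    dsimp only
    have hsq (k : ℕ) (hk : k < N) : √(q (k + 1)) * √(q (k + 1)) = q (k + 1) :=
      Real.mul_self_sqrt (hq _ (by omega) (by omega)).le
    have hse (k : ℕ) (hk : k < N) : √(e k) * √(e k) = e k := by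
      rcases k with _ | k
      · simp [he0]
      · exact Real.mul_self_sqrt (he _ (by omega) (by omega)).le
    by_cases h₁ : j = i
    · subst h₁
      rcases j with _ | m
      · simp [he0, hsq 0 hi, mul_comm]
      · simp [hsq _ hi, hse _ hi, mul_comm]
    by_cases h₂ : j = i + 1
    · subst h₂
      have hlast : √(e i) * (if i + 1 = i - 1 then √(q (i - 1 + 1)) else
          if i + 1 = i - 1 + 1 then √(e (i - 1 + 1)) else 0) = 0 := by
        rcases i with _ | m
        · simp [he0]
        · have h₃ : m + 1 + 1 ≠ m := by omega
          simp [h₃]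
      rw [hlast, hd_succ]
      simp only [Nat.succ_ne_self, ↓reduceIte]
      linear_combination d i * e (i + 1) * hsq i hi +
        d i * √(q (i + 1)) * √(q (i + 1)) * hse (i + 1) hj
    by_cases h₃ : i = j + 1
    · subst h₃
      simp only [h₁, h₂, ↓reduceIte, Nat.add_sub_cancel, hd_succ]
      ring
    · have h₄ : i = 0 ∨ j ≠ i - 1 ∧ j ≠ i - 1 + 1 := by omega
      rcases h₄ with rfl | ⟨h₄, h₅⟩
      · simp_all
      · simp [*]
  obtain ⟨hu, hconj⟩ := diagonal_inv_mul_mul_diagonal_eq hd hentry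
  refine ⟨⟨_, isDiag_diagonal _, hu, hconj⟩, ?_⟩
  obtain ⟨u, hu⟩ := hu
  rw [← hconj, ← hu, charpoly_units_conj']
end

section
/- There exists an invertible N×N real diagonal matrix D such that D⁻¹ (BBᵀ) D = Ã. In particular, Ã and BBᵀ have the same characteristic polynomial. -/
open Matrix

/-- Entry `(i, k)` of the infinite upper bidiagonal matrix with diagonal `a` and superdiagonal `b`. -/
def bidiagEntry (a b : ℕ → ℝ) (i k : ℕ) : ℝ :=
  if k = i then a i else if k = i + 1 then b i else 0

lemma sum_range_bidiagEntry_mul (a b : ℕ → ℝ) {N i : ℕ} (hi : i < N) (hb : i + 1 = N → b i = 0)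
    (f : ℕ → ℝ) :
    ∑ k ∈ Finset.range N, bidiagEntry a b i k * f k = a i * f i + b i * f (i + 1) := by
  have h : ∀ k, bidiagEntry a b i k * f k =
      (if k = i then a i * f i else 0) + (if k = i + 1 then b i * f (i + 1) else 0) := by
    intro k
    unfold bidiagEntry
    split_ifs <;> first | omega | simp_all
  simp only [h, Finset.sum_add_distrib, Finset.sum_ite_eq', Finset.mem_range, hi, if_true]
  split_ifs with h1
  · rfl
  · simp [hb (by omega)]

lemma inv_mul_mul_eq_of_mul_eq_mul {n R : Type*} [Fintype n] [DecidableEq n] [CommRing R]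
    {D M A : Matrix n n R} (hD : IsUnit D) (h : M * D = D * A) : D⁻¹ * M * D = A := by
  rw [Matrix.mul_assoc, h, ← Matrix.mul_assoc,
    Matrix.nonsing_inv_mul D ((Matrix.isUnit_iff_isUnit_det D).1 hD), Matrix.one_mul]

/-- `BBᵀ` is diagonally similar to the tridiagonal matrix `Ã`;
in particular they have the same characteristic polynomial. -/
theorem stmt_7 (N : ℕ) (hN : 0 < N) (q e : ℕ → ℝ)
    (hq : ∀ i, 1 ≤ i → i ≤ N → 0 < q i)
    (he : ∀ i, 1 ≤ i → i ≤ N - 1 → 0 < e i)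
    (heN : e N = 0)
    (B : Matrix (Fin N) (Fin N) ℝ)
    (hB : ∀ i j : Fin N,
      B i j = if (j : ℕ) = (i : ℕ) then Real.sqrt (q ((i : ℕ) + 1))
              else if (j : ℕ) = (i : ℕ) + 1 then Real.sqrt (e ((i : ℕ) + 1))
              else 0)
    (At : Matrix (Fin N) (Fin N) ℝ)
    (hAt : ∀ i j : Fin N,
      At i j = if (j : ℕ) = (i : ℕ) then q ((i : ℕ) + 1) + e ((i : ℕ) + 1)
               else if (j : ℕ) = (i : ℕ) + 1 then q ((i : ℕ) + 2) * e ((i : ℕ) + 1)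
               else if (i : ℕ) = (j : ℕ) + 1 then 1
               else 0) :
    (∃ D : Matrix (Fin N) (Fin N) ℝ, D.IsDiag ∧ IsUnit D ∧ D⁻¹ * (B * Bᵀ) * D = At) ∧
      At.charpoly = (B * Bᵀ).charpoly := by
  have hMul : ∀ i j : Fin N, (B * Bᵀ) i j =
      √(q (i + 1)) * bidiagEntry (fun k ↦ √(q (k + 1))) (fun k ↦ √(e (k + 1))) j i +
      √(e (i + 1)) * bidiagEntry (fun k ↦ √(q (k + 1))) (fun k ↦ √(e (k + 1))) j (i + 1) := by
    intro i j
    rw [← sum_range_bidiagEntry_mul (fun k ↦ √(q (k + 1))) (fun k ↦ √(e (k + 1))) i.isLt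
      (fun h ↦ by simp [h, heN]), ← Fin.sum_univ_eq_sum_range (fun k ↦
        bidiagEntry (fun k ↦ √(q (k + 1))) (fun k ↦ √(e (k + 1))) i k *
        bidiagEntry (fun k ↦ √(q (k + 1))) (fun k ↦ √(e (k + 1))) j k)]
    simp only [Matrix.mul_apply, Matrix.transpose_apply, hB, bidiagEntry]
  let d : ℕ → ℝ := fun k ↦ ∏ m ∈ Finset.range k, (√(e (m + 1)) * √(q (m + 2)))
  have hd : ∀ k, d (k + 1) = d k * (√(e (k + 1)) * √(q (k + 2))) :=
    fun k ↦ Finset.prod_range_succ _ k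
  have hd0 : ∀ i : Fin N, d i ≠ 0 := by
    intro i
    refine Finset.prod_ne_zero_iff.2 fun m hm ↦ ?_
    have hm' := Finset.mem_range.1 hm
    have h1 := Real.sqrt_pos.2 (he (m + 1) (by omega) (by omega))
    have h2 := Real.sqrt_pos.2 (hq (m + 2) (by omega) (by omega))
    positivity
  have hq' : ∀ i < N, √(q (i + 1)) * √(q (i + 1)) = q (i + 1) := fun i hi ↦
    Real.mul_self_sqrt (hq _ (by omega) (by omega)).le
  have he' : ∀ i < N, √(e (i + 1)) * √(e (i + 1)) = e (i + 1) := by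
    intro i hi
    refine Real.mul_self_sqrt ?_
    by_cases h : i + 1 = N
    · rw [h, heN]
    · exact (he _ (by omega) (by omega)).le
  let D : Matrix (Fin N) (Fin N) ℝ := Matrix.diagonal fun i ↦ d i
  have hD : IsUnit D := by
    rw [Matrix.isUnit_iff_isUnit_det, Matrix.det_diagonal]
    exact (Finset.prod_ne_zero_iff.2 fun i _ ↦ hd0 i).isUnit
  have hcomm : B * Bᵀ * D = D * At := by
    ext i j
    rw [Matrix.mul_diagonal, Matrix.diagonal_mul, hMul, hAt]
    obtain ⟨i, hi⟩ := i
    obtain ⟨j, hj⟩ := j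
    dsimp only [bidiagEntry]
    rcases lt_trichotomy i j with hij | rfl | hij
    · by_cases h : j = i + 1
      · subst h
        simp only [hd, if_true, Nat.succ_ne_self, if_false,
          show i ≠ i + 1 by omega, show i ≠ i + 1 + 1 by omega]
        linear_combination d i * √(q (i + 2)) * √(q (i + 2)) * he' i hi +
          d i * e (i + 1) * hq' (i + 1) hj
      · simp [h, show i ≠ j by omega, show i ≠ j + 1 by omega, show j ≠ i by omega,
          show i + 1 ≠ j by omega]
    · simp only [if_true, Nat.succ_ne_self, if_false]
      linear_combination d i * hq' i hi + d i * he' i hi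
    · by_cases h : i = j + 1
      · subst h
        simp only [hd, if_true, if_false, show j + 1 ≠ j by omega, show j + 1 + 1 ≠ j by omega,
          show j + 1 + 1 ≠ j + 1 by omega, show j ≠ j + 1 by omega,
          show j ≠ j + 1 + 1 by omega]
        ring
      · simp [h, show i ≠ j by omega, show i + 1 ≠ j by omega, show j ≠ i by omega,
          show j ≠ i + 1 by omega]
  have hsim : D⁻¹ * (B * Bᵀ) * D = At := inv_mul_mul_eq_of_mul_eq_mul hD hcomm
  refine ⟨⟨D, Matrix.isDiag_diagonal _, hD, hsim⟩, ?_⟩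
  obtain ⟨u, hu⟩ := hD
  rw [← hsim, ← hu, Matrix.charpoly_units_conj']
end

section
/- Define real numbers h_1^{(1)},…,h_N^{(1)} by h_1^{(1)} = 1/q_1 and h_i^{(1)} = (e_{i-1}/q_i) h_{i-1}^{(1)} + 1/q_i for i = 2,…,N. Then for every i = 1,…,N, h_i^{(1)} equals the (i,i)-entry of (BBᵀ)⁻¹. -/
open Matrix

/-- `h_i^{(1)}` equals the `(i,i)` entry of `(BBᵀ)⁻¹`. -/
theorem stmt_13 (N : ℕ) (hN : 0 < N) (q e : ℕ → ℝ)
    (hq : ∀ i, 1 ≤ i → i ≤ N → 0 < q i)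
    (he : ∀ i, 1 ≤ i → i ≤ N - 1 → 0 < e i)
    (he0 : e 0 = 0)
    (B : Matrix (Fin N) (Fin N) ℝ)
    (hB : ∀ i j : Fin N,
      B i j = if (j : ℕ) = (i : ℕ) then Real.sqrt (q ((i : ℕ) + 1))
              else if (j : ℕ) = (i : ℕ) + 1 then Real.sqrt (e ((i : ℕ) + 1))
              else 0)
    (h : ℕ → ℝ)
    (hh1 : h 1 = 1 / q 1)
    (hhi : ∀ i, 2 ≤ i → i ≤ N → h i = (e (i - 1) / q i) * h (i - 1) + 1 / q i) :
    ∀ i : Fin N, h ((i : ℕ) + 1) = (B * Bᵀ)⁻¹ i i := by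
  have hBtri : B.BlockTriangular id := by
    intro i j hij
    have hlt : (j : ℕ) < i := hij
    rw [hB, if_neg (by omega), if_neg (by omega)]
  have hdet : IsUnit B.det := by
    rw [det_of_isUpperTriangular hBtri, isUnit_iff_ne_zero, Finset.prod_ne_zero_iff]
    intro i _
    rw [hB, if_pos rfl]
    exact (Real.sqrt_pos.2 (hq _ (by omega) (by omega))).ne'
  have : Invertible B := B.invertibleOfIsUnitDet hdet
  have hCtri : (B⁻¹).BlockTriangular id := blockTriangular_inv_of_blockTriangular hBtri
  have hCB : B⁻¹ * B = 1 := nonsing_inv_mul B hdet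
  have hdiag (i : Fin N) : (B * Bᵀ)⁻¹ i i = ∑ k, B⁻¹ k i ^ 2 := by
    rw [Matrix.mul_inv_rev, ← transpose_nonsing_inv, mul_apply]
    simp only [transpose_apply, sq]
  have hone (k i : Fin N) : (1 : Matrix (Fin N) (Fin N) ℝ) k i ^ 2 =
      (1 : Matrix (Fin N) (Fin N) ℝ) k i := by
    rw [one_apply]; split_ifs <;> norm_num
  have hsum_one (i : Fin N) : ∑ k, (1 : Matrix (Fin N) (Fin N) ℝ) k i = 1 := by
    simp [one_apply]
  have key : ∀ m (hm : m < N), h (m + 1) = ∑ k, B⁻¹ k ⟨m, hm⟩ ^ 2 := by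
    intro m
    induction m with
    | zero =>
      intro hm
      have hq1 := hq 1 le_rfl hm
      have hcol (k : Fin N) : q 1 * B⁻¹ k ⟨0, hm⟩ ^ 2 =
          (1 : Matrix (Fin N) (Fin N) ℝ) k ⟨0, hm⟩ := by
        have hentry : B⁻¹ k ⟨0, hm⟩ * √(q 1) = (1 : Matrix (Fin N) (Fin N) ℝ) k ⟨0, hm⟩ := by
          rw [← hCB, mul_apply, Fintype.sum_eq_single ⟨0, hm⟩]
          · simp [hB]
          · intro x hx
            have hx' : (x : ℕ) ≠ 0 := fun hx0 => hx (Fin.ext hx0)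
            rw [hB, if_neg (by simpa using hx'.symm), if_neg (by simp), mul_zero]
        rw [← hone, ← hentry, mul_pow, Real.sq_sqrt hq1.le, mul_comm]
      have hsum := Finset.sum_congr rfl fun k (_ : k ∈ Finset.univ) => hcol k
      rw [← Finset.mul_sum, hsum_one] at hsum
      rw [zero_add, hh1, div_eq_iff hq1.ne', mul_comm, hsum]
    | succ m ih =>
      intro hm
      have hm' : m < N := by omega
      have hqm := hq (m + 2) (by omega) (by omega)
      have hem := he (m + 1) (by omega) (by omega)
      have hcol (k : Fin N) : q (m + 2) * B⁻¹ k ⟨m + 1, hm⟩ ^ 2 =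
          e (m + 1) * B⁻¹ k ⟨m, hm'⟩ ^ 2 +
            (1 : Matrix (Fin N) (Fin N) ℝ) k ⟨m + 1, hm⟩ := by
        have hentry : B⁻¹ k ⟨m + 1, hm⟩ * √(q (m + 2)) + B⁻¹ k ⟨m, hm'⟩ * √(e (m + 1)) =
            (1 : Matrix (Fin N) (Fin N) ℝ) k ⟨m + 1, hm⟩ := by
          rw [← hCB, mul_apply, Fintype.sum_eq_add ⟨m + 1, hm⟩ ⟨m, hm'⟩]
          · simp [hB]
          · simp
          · rintro x ⟨hx₁, hx₂⟩
            have hx₁' : (x : ℕ) ≠ m + 1 := fun hx => hx₁ (Fin.ext hx)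
            have hx₂' : (x : ℕ) ≠ m := fun hx => hx₂ (Fin.ext hx)
            rw [hB, if_neg (by simpa using hx₁'.symm), if_neg (by simpa using hx₂'.symm),
              mul_zero]
        have horth : (1 : Matrix (Fin N) (Fin N) ℝ) k ⟨m + 1, hm⟩ * B⁻¹ k ⟨m, hm'⟩ = 0 := by
          rw [one_apply]
          split_ifs with hk
          · rw [hk, hCtri (show id (⟨m, hm'⟩ : Fin N) < id ⟨m + 1, hm⟩ by simp), mul_zero]
          · rw [zero_mul]
        have hsolve := eq_sub_of_add_eq hentry
        calc q (m + 2) * B⁻¹ k ⟨m + 1, hm⟩ ^ 2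
            = (B⁻¹ k ⟨m + 1, hm⟩ * √(q (m + 2))) ^ 2 := by
              rw [mul_pow, Real.sq_sqrt hqm.le, mul_comm]
          _ = √(e (m + 1)) ^ 2 * B⁻¹ k ⟨m, hm'⟩ ^ 2 +
                (1 : Matrix (Fin N) (Fin N) ℝ) k ⟨m + 1, hm⟩ := by
              rw [hsolve]
              linear_combination hone k ⟨m + 1, hm⟩ - 2 * √(e (m + 1)) * horth
          _ = _ := by rw [Real.sq_sqrt hem.le]
      have hsum := Finset.sum_congr rfl fun k (_ : k ∈ Finset.univ) => hcol k
      rw [← Finset.mul_sum, Finset.sum_add_distrib, ← Finset.mul_sum, hsum_one, ← ih hm'] at hsum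
      rw [hhi (m + 1 + 1) (by omega) (by omega), Nat.add_sub_cancel, div_mul_eq_mul_div,
        ← add_div, div_eq_iff hqm.ne', mul_comm (∑ _, _), hsum]
  intro i
  rw [hdiag, key i i.isLt]
end

section
/- Define real numbers t̃h_1^{(1)},…,t̃h_N^{(1)} by t̃h_N^{(1)} = 1/q_N and t̃h_i^{(1)} = (e_i/q_i) t̃h_{i+1}^{(1)} + 1/q_i for i = 1,…,N-1. Then for every i = 1,…,N, t̃h_i^{(1)} equals the (i,i)-entry of (BᵀB)⁻¹. -/
open Matrix

/-- The diagonal entries of `(BᵀB)⁻¹` are the squared row norms of `B⁻¹`. -/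
lemma inv_transpose_mul_self_apply_diag {n : Type*} [Fintype n] [DecidableEq n]
    (B : Matrix n n ℝ) (i : n) :
    (Bᵀ * B)⁻¹ i i = ∑ j, B⁻¹ i j ^ 2 := by
  rw [Matrix.mul_inv_rev, ← Matrix.transpose_nonsing_inv, Matrix.mul_apply]
  exact Finset.sum_congr rfl fun j _ => by rw [Matrix.transpose_apply, sq]

/-- `t̃h_i^{(1)}` equals the `(i,i)` entry of `(BᵀB)⁻¹`. -/
theorem stmt_14 (N : ℕ) (hN : 0 < N) (q e : ℕ → ℝ)
    (hq : ∀ i, 1 ≤ i → i ≤ N → 0 < q i)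
    (he : ∀ i, 1 ≤ i → i ≤ N - 1 → 0 < e i)
    (B : Matrix (Fin N) (Fin N) ℝ)
    (hB : ∀ i j : Fin N,
      B i j = if (j : ℕ) = (i : ℕ) then Real.sqrt (q ((i : ℕ) + 1))
              else if (j : ℕ) = (i : ℕ) + 1 then Real.sqrt (e ((i : ℕ) + 1))
              else 0)
    (th : ℕ → ℝ)
    (hthN : th N = 1 / q N)
    (hthi : ∀ i, 1 ≤ i → i ≤ N - 1 → th i = (e i / q i) * th (i + 1) + 1 / q i) :
    ∀ i : Fin N, th ((i : ℕ) + 1) = (Bᵀ * B)⁻¹ i i := by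
  have hqpos (i : Fin N) : 0 < q ((i : ℕ) + 1) := hq _ (by omega) (by omega)
  have hdiag (i : Fin N) : B i i = √(q ((i : ℕ) + 1)) := by simp [hB]
  have hupper : B.BlockTriangular id := by
    intro i j hij
    have hlt : (j : ℕ) < i := hij
    rw [hB, if_neg (by omega), if_neg (by omega)]
  have hunit : IsUnit B.det := by
    rw [Matrix.det_of_isUpperTriangular hupper]
    refine (Finset.prod_ne_zero_iff.mpr fun i _ => ?_).isUnit
    rw [hdiag]
    exact (Real.sqrt_pos.mpr (hqpos i)).ne'
  have hmul : B * B⁻¹ = 1 := Matrix.mul_nonsing_inv B hunit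
  have : Invertible B := Matrix.invertibleOfIsUnitDet B hunit
  have hinv : B⁻¹.BlockTriangular id := Matrix.blockTriangular_inv_of_blockTriangular hupper
  have key : ∀ d : ℕ, ∀ i : Fin N, (i : ℕ) + 1 + d = N →
      th ((i : ℕ) + 1) = ∑ j, B⁻¹ i j ^ 2 := by
    intro d
    induction d with
    | zero =>
      intro i hi
      have hrow (j : Fin N) : √(q ((i : ℕ) + 1)) * B⁻¹ i j = if i = j then 1 else 0 := by
        rw [← Matrix.one_apply, ← hmul, Matrix.mul_apply, Finset.sum_eq_single i, hdiag]
        · intro k _ hk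
          have hne : (k : ℕ) ≠ i := fun h => hk (Fin.ext h)
          rw [hB, if_neg hne, if_neg (by omega), zero_mul]
        · simp
      have hsq (j : Fin N) : q ((i : ℕ) + 1) * B⁻¹ i j ^ 2 = if i = j then 1 else 0 := by
        rw [← Real.sq_sqrt (hqpos i).le, ← mul_pow, hrow]
        split_ifs <;> norm_num
      have hth : th ((i : ℕ) + 1) = 1 / q ((i : ℕ) + 1) := by
        rw [show (i : ℕ) + 1 = N from hi, hthN]
      rw [hth, div_eq_iff (hqpos i).ne', mul_comm, Finset.mul_sum]
      simp [hsq]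
    | succ d ih =>
      intro i hi
      have hepos : 0 < e ((i : ℕ) + 1) := he _ (by omega) (by omega)
      obtain ⟨i', hi'⟩ : ∃ i' : Fin N, (i' : ℕ) = i + 1 := ⟨⟨i + 1, by omega⟩, rfl⟩
      have hne : i ≠ i' := fun h => by have := congrArg Fin.val h; omega
      have hrow (j : Fin N) : √(q ((i : ℕ) + 1)) * B⁻¹ i j + √(e ((i : ℕ) + 1)) * B⁻¹ i' j =
          if i = j then 1 else 0 := by
        rw [← Matrix.one_apply, ← hmul, Matrix.mul_apply,
          Finset.sum_eq_add i i' hne _ (by simp) (by simp), hdiag, hB i i',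
          if_neg (by omega), if_pos hi']
        rintro k - ⟨hk, hk'⟩
        have hne₁ : (k : ℕ) ≠ i := fun h => hk (Fin.ext h)
        have hne₂ : (k : ℕ) ≠ i + 1 := fun h => hk' (Fin.ext (h.trans hi'.symm))
        rw [hB, if_neg hne₁, if_neg hne₂, zero_mul]
      have hzero : B⁻¹ i' i = 0 := hinv (show i < i' by rw [Fin.lt_def]; omega)
      have hsq (j : Fin N) : q ((i : ℕ) + 1) * B⁻¹ i j ^ 2 =
          (if i = j then 1 else 0) + e ((i : ℕ) + 1) * B⁻¹ i' j ^ 2 := by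
        have hsplit := eq_sub_of_add_eq (hrow j)
        have hpow := congrArg (· ^ 2) hsplit
        simp only [mul_pow, sub_sq, Real.sq_sqrt (hqpos i).le, Real.sq_sqrt hepos.le] at hpow
        rw [hpow]
        split_ifs with h
        · rw [← h, hzero]; ring
        · ring
      have hsum : q ((i : ℕ) + 1) * ∑ j, B⁻¹ i j ^ 2 =
          1 + e ((i : ℕ) + 1) * ∑ j, B⁻¹ i' j ^ 2 := by
        simp [Finset.mul_sum, hsq, Finset.sum_add_distrib]
      have hnext := ih i' (by omega)
      rw [hi'] at hnext
      rw [hthi _ (by omega) (by omega), hnext]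
      have hq0 := (hqpos i).ne'
      field_simp
      linarith
  intro i
  rw [inv_transpose_mul_self_apply_diag]
  exact key (N - (i + 1)) i (by omega)
end
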